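/- arXiv:2007.01627 — 2 statements merged into one kernel-verified Lean document; each statement's English description precedes it below -/
import Mathlib

section
/- Let Σ ∈ ℝ^{d×d} be symmetric positive definite with ‖Σ‖₂ ≤ 1, and let ν = λ_min(Σ) > 0. Let J be a nonempty proper subset of {1,…,d} with complement K, let β ∈ ℝ^d with β_K its restriction to coordinates in K, and let S ∈ ℝ^{|J|×|J|} be symmetric. Then (β_K)ᵀ Σ_{K,J} (S − (Σ_J)⁻¹) Σ_J (S − (Σ_J)⁻¹) Σ_{J,K} β_K ≤ (1/ν) ‖β‖₂² ‖I − Σ_J S‖₂². -/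
open Matrix

/-- The ℓ²→ℓ² operator norm (largest singular value) of a real matrix. -/
noncomputable def l2OpNorm {m n : Type*} [Fintype m] [Fintype n] [DecidableEq n]
    (A : Matrix m n ℝ) : ℝ :=
  ‖LinearMap.toContinuousLinearMap (Matrix.toEuclideanLin A)‖

/-- The submatrix of `Σ` keeping rows indexed by `J` and columns indexed by `K`. -/
def subMat {d : ℕ} (Sig : Matrix (Fin d) (Fin d) ℝ) (J K : Finset (Fin d)) :
    Matrix {i // i ∈ J} {i // i ∈ K} ℝ :=
  Sig.submatrix (fun j => (j : Fin d)) (fun k => (k : Fin d))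

/-- The squared ℓ² norm of `A *ᵥ x` is bounded through the operator norm of `A`. -/
lemma mulVec_dotProduct_self_le {m n : Type*} [Fintype m] [Fintype n] [DecidableEq n]
    (A : Matrix m n ℝ) (x : n → ℝ) :
    (A *ᵥ x) ⬝ᵥ (A *ᵥ x) ≤ l2OpNorm A ^ 2 * (x ⬝ᵥ x) := by
  have h := (LinearMap.toContinuousLinearMap (Matrix.toEuclideanLin A)).le_opNorm (WithLp.toLp 2 x)
  have h2 := pow_le_pow_left₀ (norm_nonneg _) h 2
  rw [mul_pow, EuclideanSpace.real_norm_sq_eq, EuclideanSpace.real_norm_sq_eq] at h2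
  simpa [l2OpNorm, dotProduct, pow_two] using h2

/-- A lower bound on the eigenvalues of a Hermitian matrix bounds the matrix from below. -/
lemma posSemidef_sub_smul_one {n : Type*} [Fintype n] [DecidableEq n]
    {A : Matrix n n ℝ} (hA : A.IsHermitian) {ν : ℝ} (h : ∀ i, ν ≤ hA.eigenvalues i) :
    (A - ν • (1 : Matrix n n ℝ)).PosSemidef := by
  have hD : (diagonal (fun i => hA.eigenvalues i - ν)).PosSemidef :=
    PosSemidef.diagonal fun i => sub_nonneg.2 (h i)
  have hU := hD.mul_mul_conjTranspose_same (hA.eigenvectorUnitary : Matrix n n ℝ)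
  have hone : (hA.eigenvectorUnitary : Matrix n n ℝ) *
      (hA.eigenvectorUnitary : Matrix n n ℝ)ᴴ = 1 :=
    Unitary.mul_star_self_of_mem hA.eigenvectorUnitary.2
  have hspec : A = (hA.eigenvectorUnitary : Matrix n n ℝ) * diagonal hA.eigenvalues *
      (hA.eigenvectorUnitary : Matrix n n ℝ)ᴴ := by
    simpa [Unitary.conjStarAlgAut_apply, star_eq_conjTranspose, Function.comp_def]
      using hA.spectral_theorem
  have hdiag : diagonal (fun i => hA.eigenvalues i - ν) =
      diagonal hA.eigenvalues - ν • (1 : Matrix n n ℝ) := by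
    rw [smul_one_eq_diagonal, diagonal_sub]
  rw [hdiag, mul_sub, sub_mul, ← hspec, mul_smul_comm, mul_one, smul_mul_assoc, hone] at hU
  exact hU

/-- A rectangular submatrix maps `x` to a vector no longer than the image of `x` extended by
zero, so it is bounded by the operator norm of the whole matrix. -/
lemma subMat_mulVec_dotProduct_self_le {d : ℕ} (A : Matrix (Fin d) (Fin d) ℝ)
    (J K : Finset (Fin d)) (x : {i // i ∈ K} → ℝ) :
    (subMat A J K *ᵥ x) ⬝ᵥ (subMat A J K *ᵥ x) ≤ l2OpNorm A ^ 2 * (x ⬝ᵥ x) := by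
  let y : Fin d → ℝ := fun i => if h : i ∈ K then x ⟨i, h⟩ else 0
  have hsum (f : Fin d → ℝ) : ∑ i, f i * y i = ∑ k : {i // i ∈ K}, f k * x k := by
    rw [← Finset.sum_subset (Finset.subset_univ K) (fun i _ hi => by simp [y, hi]),
      ← Finset.sum_coe_sort]
    exact Finset.sum_congr rfl fun k _ => by simp [y]
  have hy : y ⬝ᵥ y = x ⬝ᵥ x := by
    rw [dotProduct, hsum]
    exact Finset.sum_congr rfl fun k _ => by simp [y]
  have hmul (j : {i // i ∈ J}) : (subMat A J K *ᵥ x) j = (A *ᵥ y) j :=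
    (hsum (A j)).symm
  calc (subMat A J K *ᵥ x) ⬝ᵥ (subMat A J K *ᵥ x)
      = ∑ j ∈ J, (A *ᵥ y) j * (A *ᵥ y) j := by
        rw [← Finset.sum_coe_sort J]
        exact Finset.sum_congr rfl fun j _ => by rw [hmul]
    _ ≤ (A *ᵥ y) ⬝ᵥ (A *ᵥ y) :=
        Finset.sum_le_sum_of_subset_of_nonneg (Finset.subset_univ J)
          fun i _ _ => mul_self_nonneg _
    _ ≤ l2OpNorm A ^ 2 * (x ⬝ᵥ x) := hy ▸ mulVec_dotProduct_self_le A y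

/-- If `A ≥ ν` on `u`, then `uᵀ A u ≤ ‖A u‖² / ν`. -/
lemma dotProduct_mulVec_le_of_le {n : Type*} [Fintype n] (A : Matrix n n ℝ) {ν : ℝ} (hν : 0 < ν)
    (u : n → ℝ) (h : ν * (u ⬝ᵥ u) ≤ u ⬝ᵥ (A *ᵥ u)) :
    u ⬝ᵥ (A *ᵥ u) ≤ 1 / ν * ((A *ᵥ u) ⬝ᵥ (A *ᵥ u)) := by
  have hsq : 0 ≤ (A *ᵥ u - ν • u) ⬝ᵥ (A *ᵥ u - ν • u) :=
    Finset.sum_nonneg fun i _ => mul_self_nonneg _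
  simp only [sub_dotProduct, dotProduct_sub, smul_dotProduct, dotProduct_smul, smul_eq_mul,
    dotProduct_comm (A *ᵥ u) u] at hsq
  have hmul := mul_le_mul_of_nonneg_left h hν.le
  rw [one_div, ← div_eq_inv_mul, le_div_iff₀ hν]
  linarith

/-- Let `Σ` be symmetric positive definite with `‖Σ‖₂ ≤ 1` and smallest
eigenvalue `ν > 0`.  Let `J` be a nonempty proper subset of `{1,…,d}` with
complement `K`, `β ∈ ℝ^d` with restriction `β_K`, and `S` symmetric.  Then
`β_Kᵀ Σ_{K,J} (S − Σ_J⁻¹) Σ_J (S − Σ_J⁻¹) Σ_{J,K} β_K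
  ≤ (1/ν) ‖β‖₂² ‖I − Σ_J S‖₂²`. -/
theorem stmt_14 {d : ℕ} (Sig : Matrix (Fin d) (Fin d) ℝ) (hSig : Sig.PosDef)
    (hnorm : l2OpNorm Sig ≤ 1)
    (ν : ℝ) (hν : 0 < ν)
    (hνmem : ∃ i, hSig.1.eigenvalues i = ν)
    (hνmin : ∀ i, ν ≤ hSig.1.eigenvalues i)
    (J : Finset (Fin d)) (hJ : J.Nonempty) (hJproper : J ≠ Finset.univ)
    (β : Fin d → ℝ) (βK : {i // i ∈ Jᶜ} → ℝ) (hβK : ∀ k, βK k = β k)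
    (S : Matrix {i // i ∈ J} {i // i ∈ J} ℝ) (hS : Sᵀ = S) :
    βK ⬝ᵥ ((subMat Sig Jᶜ J * (S - (subMat Sig J J)⁻¹) * subMat Sig J J *
        (S - (subMat Sig J J)⁻¹) * subMat Sig J Jᶜ) *ᵥ βK) ≤
      (1 / ν) * (∑ i, β i ^ 2) * (l2OpNorm (1 - subMat Sig J J * S)) ^ 2 := by
  have hsymm : Sigᵀ = Sig := by simpa [IsHermitian] using hSig.1
  have hA : (subMat Sig J J).PosDef := hSig.submatrix Subtype.val_injective
  set A := subMat Sig J J with hAdef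
  set T := S - A⁻¹ with hT
  set v := subMat Sig J Jᶜ *ᵥ βK with hv
  have hAsymm : Aᵀ = A := by simpa [IsHermitian] using hA.1
  have hTsymm : Tᵀ = T := by
    rw [hT, transpose_sub, hS, transpose_nonsing_inv, hAsymm]
  have hBsymm : subMat Sig Jᶜ J = (subMat Sig J Jᶜ)ᵀ := by
    conv_lhs => rw [← hsymm]
    rfl
  have hAT : A *ᵥ (T *ᵥ v) = -((1 - A * S) *ᵥ v) := by
    rw [mulVec_mulVec, ← neg_mulVec, hT, mul_sub,
      mul_nonsing_inv _ ((isUnit_iff_isUnit_det A).1 hA.isUnit), neg_sub]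
  have hlhs : βK ⬝ᵥ ((subMat Sig Jᶜ J * T * A * T * subMat Sig J Jᶜ) *ᵥ βK) =
      (T *ᵥ v) ⬝ᵥ (A *ᵥ (T *ᵥ v)) := by
    simp only [← mulVec_mulVec, ← hv]
    rw [hBsymm, dotProduct_mulVec, vecMul_transpose, ← hv, dotProduct_mulVec v T,
      ← mulVec_transpose, hTsymm]
  have hlow : ν * ((T *ᵥ v) ⬝ᵥ (T *ᵥ v)) ≤ (T *ᵥ v) ⬝ᵥ (A *ᵥ (T *ᵥ v)) := by
    have h := (posSemidef_sub_smul_one hSig.1 hνmin).submatrix (fun j : {i // i ∈ J} => (j : Fin d))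
    have heq : (Sig - ν • (1 : Matrix (Fin d) (Fin d) ℝ)).submatrix
        (fun j : {i // i ∈ J} => (j : Fin d)) (fun j : {i // i ∈ J} => (j : Fin d)) =
        A - ν • 1 := by
      rw [submatrix_sub, Pi.sub_apply, Pi.sub_apply, submatrix_smul, Pi.smul_apply, Pi.smul_apply,
        submatrix_one _ Subtype.val_injective]
      rfl
    rw [heq] at h
    have h' := h.dotProduct_mulVec_nonneg (T *ᵥ v)
    rw [star_trivial, sub_mulVec A, smul_mulVec, one_mulVec, dotProduct_sub, dotProduct_smul,
      smul_eq_mul] at h'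
    exact sub_nonneg.1 h'
  have hvle : v ⬝ᵥ v ≤ ∑ i, β i ^ 2 := by
    have hK : βK ⬝ᵥ βK ≤ ∑ i, β i ^ 2 := by
      calc βK ⬝ᵥ βK = ∑ i ∈ Jᶜ, β i ^ 2 := by
            rw [← Finset.sum_coe_sort]
            exact Finset.sum_congr rfl fun k _ => by rw [hβK, pow_two]
        _ ≤ ∑ i, β i ^ 2 :=
            Finset.sum_le_sum_of_subset_of_nonneg (Finset.subset_univ _)
              fun i _ _ => sq_nonneg _
    have hKnn : 0 ≤ βK ⬝ᵥ βK := Finset.sum_nonneg fun i _ => mul_self_nonneg _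
    have hone : l2OpNorm Sig ^ 2 ≤ 1 := pow_le_one₀ (norm_nonneg _) hnorm
    calc v ⬝ᵥ v ≤ l2OpNorm Sig ^ 2 * (βK ⬝ᵥ βK) := subMat_mulVec_dotProduct_self_le Sig J Jᶜ βK
      _ ≤ βK ⬝ᵥ βK := mul_le_of_le_one_left hKnn hone
      _ ≤ _ := hK
  calc _ = (T *ᵥ v) ⬝ᵥ (A *ᵥ (T *ᵥ v)) := hlhs
    _ ≤ 1 / ν * ((A *ᵥ (T *ᵥ v)) ⬝ᵥ (A *ᵥ (T *ᵥ v))) := dotProduct_mulVec_le_of_le A hν _ hlow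
    _ = 1 / ν * (((1 - A * S) *ᵥ v) ⬝ᵥ ((1 - A * S) *ᵥ v)) := by
        rw [hAT, neg_dotProduct_neg]
    _ ≤ 1 / ν * (l2OpNorm (1 - A * S) ^ 2 * (v ⬝ᵥ v)) := by
        gcongr
        exact mulVec_dotProduct_self_le _ _
    _ ≤ 1 / ν * (l2OpNorm (1 - A * S) ^ 2 * ∑ i, β i ^ 2) := by gcongr
    _ = _ := by ring
end

section
/- Let d ≥ 1, W ∈ ℝ^{d×d}, μ ∈ ℝ^d, c ∈ ℝ^d, and R > 0. Then there exist matrices W_X, W_M ∈ ℝ^{d×d}, a bias b ∈ ℝ^d, and constants γ ∈ ℝ^d such that W_X = W and, for every x ∈ ℝ^d with |x_i| ≤ R for all i and every mask m ∈ {0,1}^d, ReLU( W_X (x ⊙ (1−m)) + W_M m + b ) = ( W ((x−μ) ⊙ (1−m)) + c + γ ) ⊙ m, where ReLU and ⊙ m are applied entrywise. In particular, a ReLU hidden layer taking as input the zero-imputed data concatenated with the mask can reproduce, up to per-unit constants, a hidden layer with the ⊙M (multiplication-by-mask) nonlinearity: the same hidden units are activated, activated units agree up to the constant γ_k, and non-activated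 units output 0 on both sides. (Equivalence between an MLP hidden layer and a depth-1 NeuMiss layer, Proposition 4.) -/
open Matrix

/-- On the box `|xⱼ| ≤ R`, the row sum `∑ⱼ wⱼ (xⱼ (1 - mⱼ) + μⱼ mⱼ)` of a `0`-`1` mask `m` is bounded
independently of `x` and `m`. -/
theorem abs_sum_mask_le {ι : Type*} [Fintype ι] (w μ x m : ι → ℝ) {R : ℝ}
    (hx : ∀ j, |x j| ≤ R) (hm : ∀ j, m j = 0 ∨ m j = 1) :
    |∑ j, w j * (x j * (1 - m j) + μ j * m j)| ≤ ∑ j, |w j| * (R + |μ j|) := by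
  refine (Finset.abs_sum_le_sum_abs _ _).trans (Finset.sum_le_sum fun j _ => ?_)
  rw [abs_mul]
  refine mul_le_mul_of_nonneg_left ?_ (abs_nonneg _)
  have hμ := abs_nonneg (μ j)
  have hR := (abs_nonneg (x j)).trans (hx j)
  rcases hm j with h | h
  · simpa [h] using (hx j).trans (le_add_of_nonneg_right hμ)
  · simpa [h] using hR

/-- **Equivalence between an MLP hidden layer and a depth-1 NeuMiss layer
(Proposition 4).**  Let `W ∈ ℝ^{d×d}`, `μ, c ∈ ℝ^d` and `R > 0`.  There exist
weights `W_X = W`, `W_M`, a bias `b` and per-unit constants `γ` such that for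
every input `x` with `|xᵢ| ≤ R` and every mask `m ∈ {0,1}^d`, entrywise
`ReLU(W_X (x ⊙ (1−m)) + W_M m + b) = (W ((x−μ) ⊙ (1−m)) + c + γ) ⊙ m`. -/
theorem stmt_16 {d : ℕ} (hd : 1 ≤ d) (W : Matrix (Fin d) (Fin d) ℝ)
    (μ c : Fin d → ℝ) (R : ℝ) (hR : 0 < R) :
    ∃ (WX WM : Matrix (Fin d) (Fin d) ℝ) (b γ : Fin d → ℝ),
      WX = W ∧
      ∀ x m : Fin d → ℝ, (∀ i, |x i| ≤ R) → (∀ i, m i = 0 ∨ m i = 1) →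
        ∀ k, max ((WX *ᵥ (x * (1 - m)) + WM *ᵥ m + b) k) 0 =
          ((W *ᵥ ((x - μ) * (1 - m)) + c + γ) * m) k := by
  let B : Fin d → ℝ := fun k => ∑ j, |W k j| * (R + |μ j|)
  refine ⟨W, W * diagonal μ + diagonal fun j => 2 * B j, -B, B + W *ᵥ μ - c, rfl, ?_⟩
  intro x m hx hm k
  have hB := abs_le.mp (abs_sum_mask_le (W k) μ x m hx hm)
  have hpre : (W *ᵥ (x * (1 - m)) + (W * diagonal μ + diagonal fun j => 2 * B j) *ᵥ m + -B : Fin d → ℝ) k =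
      ∑ j, W k j * (x j * (1 - m j) + μ j * m j) + 2 * B k * m k - B k := by
    simp only [add_mulVec, Pi.add_apply, mulVec_diagonal, Pi.neg_apply]
    simp only [mulVec, dotProduct, mul_diagonal, Pi.mul_apply, Pi.sub_apply, Pi.one_apply,
      mul_add, Finset.sum_add_distrib, mul_assoc]
    ring
  have hout : (W *ᵥ ((x - μ) * (1 - m)) + c + (B + W *ᵥ μ - c)) k =
      ∑ j, W k j * (x j * (1 - m j) + μ j * m j) + B k := by
    have hsum : (W *ᵥ ((x - μ) * (1 - m))) k + (W *ᵥ μ) k =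
        ∑ j, W k j * (x j * (1 - m j) + μ j * m j) := by
      simp only [mulVec, dotProduct, Pi.mul_apply, Pi.sub_apply, Pi.one_apply]
      rw [← Finset.sum_add_distrib]
      exact Finset.sum_congr rfl fun j _ => by ring
    simp only [Pi.add_apply, Pi.sub_apply]
    linarith
  rw [Pi.mul_apply, hpre, hout]
  rcases hm k with h | h
  · rw [h, mul_zero, mul_zero, max_eq_right]
    linarith [hB.2]
  · rw [h, mul_one, mul_one, max_eq_left]
    · ring
    · linarith [hB.1]
end
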